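/- If θ ≥ 1 and 0 < ρ < 1, then I(t)/(R(t)q(t)) → 1 and I(t) → 0 as t → ∞, and consequently P_t/(R(t)q(t)) → 1, i.e. P{Y(t) > 0} ∼ R(t)q(t) as t → ∞. -/

import Mathlib

open Filter MeasureTheory Set in
/-- The part of the convolution of two non-increasing functions away from the singularity of the
first factor is integrable. -/
lemma AntitoneOn.intervalIntegrable_conv_left {f g : ℝ → ℝ} (hf : AntitoneOn f (Ioi 0))
    (hfpos : ∀ t > (0:ℝ), 0 < f t) (hg : ∀ t > (0:ℝ), IntegrableOn g (Ioc 0 t))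
    {s t : ℝ} (hs : 0 < s) (hst : s < t) :
    IntervalIntegrable (fun u => f (t - u) * g u) volume 0 s := by
  rw [intervalIntegrable_iff_integrableOn_Ioc_of_le hs.le]
  have hmono : MonotoneOn (fun u => f (t - u)) (Ioc 0 s) := fun x hx y hy hxy =>
    hf (mem_Ioi.2 (by linarith [hy.2])) (mem_Ioi.2 (by linarith [hx.2])) (by linarith)
  refine Integrable.bdd_mul (c := f (t - s)) (hg s hs)
    (aemeasurable_restrict_of_monotoneOn measurableSet_Ioc hmono).aestronglyMeasurable ?_
  filter_upwards [ae_restrict_mem measurableSet_Ioc] with u hu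
  rw [Real.norm_of_nonneg (hfpos _ (by linarith [hu.2])).le]
  exact hmono hu ⟨hs, le_rfl⟩ hu.2

open Filter MeasureTheory Set in
/-- Bound for the part of a convolution away from the singularity of the first factor. -/
lemma AntitoneOn.integral_conv_left_le {f g : ℝ → ℝ} (hf : AntitoneOn f (Ioi 0))
    (hfpos : ∀ t > (0:ℝ), 0 < f t) (hgpos : ∀ t > (0:ℝ), 0 < g t)
    (hg : ∀ t > (0:ℝ), IntegrableOn g (Ioc 0 t))
    {s t : ℝ} (hs : 0 < s) (hst : s < t) :
    ∫ u in (0:ℝ)..s, f (t - u) * g u ≤ f (t - s) * ∫ u in (0:ℝ)..s, g u := by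
  rw [← intervalIntegral.integral_const_mul]
  refine intervalIntegral.integral_mono_on_of_le_Ioo hs.le
    (hf.intervalIntegrable_conv_left hfpos hg hs hst)
    (((intervalIntegrable_iff_integrableOn_Ioc_of_le hs.le).2 (hg s hs)).const_mul _) ?_
  intro u hu
  exact mul_le_mul_of_nonneg_right
    (hf (mem_Ioi.2 (by linarith)) (mem_Ioi.2 (by linarith [hu.2])) (by linarith [hu.2]))
    (hgpos u hu.1).le

open Filter MeasureTheory Set in
/-- The part of the convolution of two functions away from the singularity of the non-increasing
second factor is integrable. -/
lemma AntitoneOn.intervalIntegrable_conv_right {f g : ℝ → ℝ} (hg : AntitoneOn g (Ioi 0))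
    (hgpos : ∀ t > (0:ℝ), 0 < g t) (hfint : ∀ t > (0:ℝ), IntegrableOn f (Ioc 0 t))
    {s t : ℝ} (hs : 0 < s) (hst : s < t) :
    IntervalIntegrable (fun u => f (t - u) * g u) volume s t := by
  have h := (hg.intervalIntegrable_conv_left hgpos hfint (sub_pos.2 hst)
    (sub_lt_self t hs)).comp_sub_left t
  simp only [sub_zero, sub_sub_cancel] at h
  simpa only [mul_comm] using h.symm

open Filter MeasureTheory Set in
/-- Upper bound for a convolution obtained by splitting the domain of integration. -/
lemma AntitoneOn.integral_conv_le {f g : ℝ → ℝ} (hf : AntitoneOn f (Ioi 0))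
    (hg : AntitoneOn g (Ioi 0)) (hfpos : ∀ t > (0:ℝ), 0 < f t) (hgpos : ∀ t > (0:ℝ), 0 < g t)
    (hfint : ∀ t > (0:ℝ), IntegrableOn f (Ioc 0 t)) (hgint : ∀ t > (0:ℝ), IntegrableOn g (Ioc 0 t))
    {s t : ℝ} (hs : 0 < s) (hst : s < t) :
    ∫ u in (0:ℝ)..t, f (t - u) * g u ≤
      f (t - s) * (∫ u in (0:ℝ)..s, g u) + g s * ∫ u in (0:ℝ)..(t - s), f u := by
  rw [← intervalIntegral.integral_add_adjacent_intervals
    (hf.intervalIntegrable_conv_left hfpos hgint hs hst)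
    (hg.intervalIntegrable_conv_right hgpos hfint hs hst)]
  refine add_le_add (hf.integral_conv_left_le hfpos hgpos hgint hs hst) ?_
  have h := hg.integral_conv_left_le hgpos hfpos hfint (sub_pos.2 hst) (sub_lt_self t hs)
  have h2 := intervalIntegral.integral_comp_sub_left (a := s) (b := t)
    (fun u => g (t - u) * f u) t
  simp only [sub_self, sub_sub_cancel] at h2 h
  rw [← h2] at h
  simpa only [mul_comm (f _)] using h

open Filter MeasureTheory Set in
/-- Lower bound for a convolution by the value of the second factor at the endpoint. -/
lemma AntitoneOn.le_integral_conv {f g : ℝ → ℝ} (hf : AntitoneOn f (Ioi 0))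
    (hg : AntitoneOn g (Ioi 0)) (hfpos : ∀ t > (0:ℝ), 0 < f t) (hgpos : ∀ t > (0:ℝ), 0 < g t)
    (hfint : ∀ t > (0:ℝ), IntegrableOn f (Ioc 0 t)) (hgint : ∀ t > (0:ℝ), IntegrableOn g (Ioc 0 t))
    {t : ℝ} (ht : 0 < t) :
    (∫ u in (0:ℝ)..t, f u) * g t ≤ ∫ u in (0:ℝ)..t, f (t - u) * g u := by
  have h2 := intervalIntegral.integral_comp_sub_left (a := 0) (b := t) f t
  simp only [sub_self, sub_zero] at h2
  rw [← h2, ← intervalIntegral.integral_mul_const]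
  have hfi := ((intervalIntegrable_iff_integrableOn_Ioc_of_le ht.le).2
    (hfint t ht)).comp_sub_left t
  simp only [sub_self, sub_zero] at hfi
  refine intervalIntegral.integral_mono_on_of_le_Ioo ht.le (hfi.symm.mul_const _)
    ((hf.intervalIntegrable_conv_left hfpos hgint (half_pos ht) (half_lt_self ht)).trans
      (hg.intervalIntegrable_conv_right hgpos hfint (half_pos ht) (half_lt_self ht))) ?_
  intro u hu
  exact mul_le_mul_of_nonneg_left (hg (mem_Ioi.2 hu.1) (mem_Ioi.2 ht) hu.2.le)
    (hfpos _ (by linarith [hu.2])).le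

open MeasureTheory Set in
/-- The increment of the primitive of a non-increasing function. -/
lemma AntitoneOn.integral_sub_bounds {f : ℝ → ℝ} (hf : AntitoneOn f (Ioi 0))
    (hfint : ∀ t > (0:ℝ), IntegrableOn f (Ioc 0 t)) {a b : ℝ} (ha : 0 < a) (hab : a ≤ b) :
    (b - a) * f b ≤ (∫ u in (0:ℝ)..b, f u) - ∫ u in (0:ℝ)..a, f u ∧
      (∫ u in (0:ℝ)..b, f u) - (∫ u in (0:ℝ)..a, f u) ≤ (b - a) * f a := by
  have hb := ha.trans_le hab
  have hia := (intervalIntegrable_iff_integrableOn_Ioc_of_le ha.le).2 (hfint a ha)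
  have hib := (intervalIntegrable_iff_integrableOn_Ioc_of_le hb.le).2 (hfint b hb)
  have hi := hia.symm.trans hib
  rw [intervalIntegral.integral_interval_sub_left hib hia]
  constructor
  · have := intervalIntegral.integral_mono_on hab (intervalIntegrable_const (c := f b)) hi
      fun x hx => hf (mem_Ioi.2 (ha.trans_le hx.1)) (mem_Ioi.2 hb) hx.2
    simpa using this
  · have := intervalIntegral.integral_mono_on hab hi (intervalIntegrable_const (c := f a))
      fun x hx => hf (mem_Ioi.2 ha) (mem_Ioi.2 (ha.trans_le hx.1)) hx.1
    simpa using this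

open MeasureTheory Set in
lemma integral_pos_of_forall_pos {f : ℝ → ℝ} (hfpos : ∀ t > (0:ℝ), 0 < f t)
    (hfint : ∀ t > (0:ℝ), IntegrableOn f (Ioc 0 t)) {t : ℝ} (ht : 0 < t) :
    0 < ∫ u in (0:ℝ)..t, f u :=
  intervalIntegral.intervalIntegral_pos_of_pos_on
    ((intervalIntegrable_iff_integrableOn_Ioc_of_le ht.le).2 (hfint t ht))
    (fun x hx => hfpos x hx.1) ht

/-- A function that is bounded on `[T, 2T]` and does not leave `(-∞, M]` under doubling of the
argument is bounded on `[T, ∞)`. -/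
lemma le_of_doubling {f : ℝ → ℝ} {T M : ℝ} (hT : 0 < T)
    (hbase : ∀ t, T ≤ t → t ≤ 2 * T → f t ≤ M)
    (hstep : ∀ t, T ≤ t → f t ≤ M → f (2 * t) ≤ M) {t : ℝ} (ht : T ≤ t) : f t ≤ M := by
  have key : ∀ n : ℕ, ∀ t, T ≤ t → t ≤ 2 ^ n * (2 * T) → f t ≤ M := by
    intro n
    induction n with
    | zero => simpa using hbase
    | succ n ih =>
      intro t ht ht'
      rcases le_total t (2 * T) with h | h
      · exact hbase t ht h
      · have h1 : T ≤ t / 2 := by linarith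
        have := hstep _ h1 (ih _ h1 (by rw [pow_succ] at ht'; linarith))
        rwa [mul_div_cancel₀ t two_ne_zero] at this
  obtain ⟨n, hn⟩ := pow_unbounded_of_one_lt (t / (2 * T)) (one_lt_two (α := ℝ))
  exact key n t ht ((div_lt_iff₀ (by positivity)).1 hn).le

open Filter in
/-- A nonnegative function, bounded on compact sets, that contracts under doubling of the argument
tends to zero. -/
lemma tendsto_zero_of_doubling {f : ℝ → ℝ} {T M l : ℝ} (hT : 0 < T) (hl0 : 0 ≤ l) (hl1 : l < 1)
    (hM : 0 ≤ M) (hf : ∀ t, T ≤ t → 0 ≤ f t)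
    (hbase : ∀ t, T ≤ t → t ≤ 2 * T → f t ≤ M)
    (hstep : ∀ t, T ≤ t → f (2 * t) ≤ l * f t) : Tendsto f atTop (nhds 0) := by
  have key : ∀ n : ℕ, ∀ t, 2 ^ n * T ≤ t → f t ≤ l ^ n * M := by
    intro n
    induction n with
    | zero =>
      intro t ht
      simp only [pow_zero, one_mul] at ht ⊢
      exact le_of_doubling hT hbase (fun t ht h => (hstep t ht).trans (by nlinarith)) ht
    | succ n ih =>
      intro t ht
      have h1 : 2 ^ n * T ≤ t / 2 := by rw [pow_succ] at ht; linarith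
      have h2 : T ≤ t / 2 :=
        (le_mul_of_one_le_left hT.le (one_le_pow₀ one_le_two)).trans h1
      have := hstep _ h2
      rw [mul_div_cancel₀ t two_ne_zero] at this
      calc f t ≤ l * f (t / 2) := this
        _ ≤ l * (l ^ n * M) := mul_le_mul_of_nonneg_left (ih _ h1) hl0
        _ = l ^ (n + 1) * M := by ring
  have hlim : Tendsto (fun n : ℕ => l ^ n * M) atTop (nhds 0) := by
    simpa using (tendsto_pow_atTop_nhds_zero_of_lt_one hl0 hl1).mul_const M
  refine tendsto_order.2 ⟨fun a ha => ?_, fun a ha => ?_⟩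
  · filter_upwards [eventually_ge_atTop T] with t ht using ha.trans_le (hf t ht)
  · obtain ⟨n, hn⟩ := (hlim.eventually (gt_mem_nhds ha)).exists
    filter_upwards [eventually_ge_atTop (2 ^ n * T)] with t ht using (key n t ht).trans_lt hn

open Filter MeasureTheory Set in
/-- For a non-increasing `f` that is regularly varying with index `-θ`, `θ ≥ 1`, the product
`t * f t` is negligible compared to the primitive of `f`. -/
lemma tendsto_mul_div_integral_zero {f : ℝ → ℝ} {θ : ℝ} (hθ : 1 ≤ θ)
    (hf : AntitoneOn f (Ioi 0)) (hfpos : ∀ t > (0:ℝ), 0 < f t)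
    (hfint : ∀ t > (0:ℝ), IntegrableOn f (Ioc 0 t))
    (hrv : ∀ c > (0:ℝ), Tendsto (fun t => f (c * t) / f t) atTop (nhds (c ^ (-θ)))) :
    Tendsto (fun t => t * f t / ∫ u in (0:ℝ)..t, f u) atTop (nhds 0) := by
  have hhalf : Tendsto (fun t : ℝ => (1 / 2 : ℝ) * t) atTop atTop :=
    tendsto_id.const_mul_atTop (by norm_num)
  have hL : (2:ℝ) ≤ (1 / 2 : ℝ) ^ (-θ) := by
    rw [one_div, Real.inv_rpow zero_le_two, Real.rpow_neg zero_le_two, inv_inv]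
    simpa using Real.rpow_le_rpow_of_exponent_le one_le_two hθ
  have key : ∀ n : ℕ, ∀ᶠ t in atTop, (n / 4 : ℝ) * (t * f t) ≤ ∫ u in (0:ℝ)..t, f u := by
    intro n
    induction n with
    | zero =>
      filter_upwards [eventually_gt_atTop 0] with t ht
      simpa using (integral_pos_of_forall_pos hfpos hfint ht).le
    | succ n ih =>
      have hlt : 2 - 2 / (n + 1 : ℝ) < (1 / 2 : ℝ) ^ (-θ) := by
        have : 0 < 2 / (n + 1 : ℝ) := by positivity
        linarith
      filter_upwards [hhalf.eventually ih, eventually_gt_atTop 0,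
        (hrv (1 / 2) (by norm_num)).eventually (lt_mem_nhds hlt)] with t h1 ht h2
      have hft := hfpos t ht
      have h3 := (hf.integral_sub_bounds hfint (a := 1 / 2 * t) (b := t) (by linarith)
        (by linarith)).1
      rw [lt_div_iff₀ hft] at h2
      have h4 : (n / 4 : ℝ) * (1 / 2 * t * ((2 - 2 / (n + 1 : ℝ)) * f t)) ≤
          (n / 4 : ℝ) * (1 / 2 * t * f (1 / 2 * t)) := by gcongr
      have h5 : (n / 4 : ℝ) * (1 / 2 * t * ((2 - 2 / (n + 1 : ℝ)) * f t)) =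
          (n / 4 : ℝ) * (t * f t) - (1 / 4) * (n / (n + 1 : ℝ)) * (t * f t) := by
        field_simp
      have h6 : (n / (n + 1 : ℝ)) * (t * f t) ≤ 1 * (t * f t) := by
        gcongr
        rw [div_le_one (by positivity)]
        linarith
      push_cast
      linarith
  refine tendsto_order.2 ⟨fun a ha => ?_, fun a ha => ?_⟩
  · filter_upwards [eventually_gt_atTop 0] with t ht
    have := hfpos t ht
    have := integral_pos_of_forall_pos hfpos hfint ht
    exact ha.trans_le (by positivity)
  · obtain ⟨n, hn⟩ := exists_nat_gt (4 / a)
    filter_upwards [eventually_gt_atTop 0, key n] with t ht h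
    have hft := hfpos t ht
    rw [div_lt_iff₀ (integral_pos_of_forall_pos hfpos hfint ht)]
    have h1 : 1 < a * (n / 4 : ℝ) := by
      rw [div_lt_iff₀ ha] at hn
      linarith
    calc t * f t = 1 * (t * f t) := (one_mul _).symm
      _ < a * (n / 4 : ℝ) * (t * f t) := by gcongr
      _ = a * ((n / 4 : ℝ) * (t * f t)) := by ring
      _ ≤ _ := by gcongr

open Filter MeasureTheory Set in
/-- For a non-increasing `g` that is regularly varying with index `-ρ`, `ρ < 1`, the primitive of
`g` is at most of order `t * g t`. -/
lemma exists_integral_le_mul {g : ℝ → ℝ} {ρ : ℝ} (hρ : ρ < 1)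
    (hg : AntitoneOn g (Ioi 0)) (hgpos : ∀ t > (0:ℝ), 0 < g t)
    (hgint : ∀ t > (0:ℝ), IntegrableOn g (Ioc 0 t))
    (hrv : ∀ c > (0:ℝ), Tendsto (fun t => g (c * t) / g t) atTop (nhds (c ^ (-ρ)))) :
    ∃ M : ℝ, 0 ≤ M ∧ ∀ᶠ t in atTop, ∫ u in (0:ℝ)..t, g u ≤ M * (t * g t) := by
  have hlt : (1 / 2 : ℝ) < 2 ^ (-ρ) := by
    have := Real.rpow_lt_rpow_of_exponent_lt (one_lt_two (α := ℝ)) (neg_lt_neg hρ)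
    rwa [Real.rpow_neg_one, ← one_div] at this
  obtain ⟨m, hm, hm'⟩ := exists_between hlt
  obtain ⟨T, hT, hT'⟩ := ((eventually_ge_atTop (1:ℝ)).and
    (eventually_forall_ge_atTop.2 ((hrv 2 two_pos).eventually (lt_mem_nhds hm')))).exists
  have hTpos : 0 < T := by linarith
  set G := fun t => ∫ u in (0:ℝ)..t, g u with hG
  set M := max (G (2 * T) / (T * g (2 * T))) (1 / (2 * m - 1)) with hMdef
  have hm1 : 0 < 2 * m - 1 := by linarith
  have hM0 : 0 ≤ M := le_max_of_le_right (by positivity)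
  have hM1 : 1 ≤ M * (2 * m - 1) := (div_le_iff₀ hm1).1 (le_max_right _ _)
  refine ⟨M, hM0, ?_⟩
  filter_upwards [eventually_ge_atTop T] with t ht
  have h2T := hgpos (2 * T) (by linarith)
  rw [← sub_nonpos]
  refine le_of_doubling (f := fun t => G t - M * (t * g t)) hTpos ?_ ?_ ht
  · intro t ht ht'
    have h1 : G t ≤ G (2 * T) := by
      have := (hg.integral_sub_bounds hgint (a := t) (b := 2 * T) (by linarith) ht').1
      have : 0 ≤ (2 * T - t) * g (2 * T) := mul_nonneg (by linarith) h2T.le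
      simp only [hG]
      linarith
    have h2 : G (2 * T) ≤ M * (T * g (2 * T)) :=
      (div_le_iff₀ (by positivity)).1 (le_max_left _ _)
    have h3 : M * (T * g (2 * T)) ≤ M * (t * g t) := by
      have := hg (mem_Ioi.2 (hTpos.trans_le ht)) (mem_Ioi.2 (by linarith)) ht'
      have : 0 ≤ t := by linarith
      gcongr
    linarith
  · intro t ht h
    have htpos := hTpos.trans_le ht
    have hgt := hgpos t htpos
    have h1 := (hg.integral_sub_bounds hgint (a := t) (b := 2 * t) htpos (by linarith)).2
    have h2 := (lt_div_iff₀ hgt).1 (hT' t ht)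
    have h3 : M * (2 * t * (m * g t)) ≤ M * (2 * t * g (2 * t)) := by gcongr
    have h4 : 1 * (t * g t) ≤ M * (2 * m - 1) * (t * g t) := by gcongr
    simp only [hG] at h h1 ⊢
    linarith

open Filter MeasureTheory Set in
/-- The product of the primitive of `f` and `g` vanishes at infinity. -/
lemma tendsto_integral_mul_zero {f g : ℝ → ℝ} {ρ : ℝ} (hρ : 0 < ρ)
    (hf : AntitoneOn f (Ioi 0)) (hg : AntitoneOn g (Ioi 0))
    (hfpos : ∀ t > (0:ℝ), 0 < f t) (hgpos : ∀ t > (0:ℝ), 0 < g t)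
    (hfint : ∀ t > (0:ℝ), IntegrableOn f (Ioc 0 t))
    (hsmall : Tendsto (fun t => t * f t / ∫ u in (0:ℝ)..t, f u) atTop (nhds 0))
    (hrv : Tendsto (fun t => g (2 * t) / g t) atTop (nhds (2 ^ (-ρ)))) :
    Tendsto (fun t => (∫ u in (0:ℝ)..t, f u) * g t) atTop (nhds 0) := by
  have hlt : (2 : ℝ) ^ (-ρ) < 1 := Real.rpow_lt_one_of_one_lt_of_neg one_lt_two (by linarith)
  have hlim := (hsmall.const_add 1).mul hrv
  rw [add_zero, one_mul] at hlim
  obtain ⟨l, hl, hl1⟩ := exists_between hlt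
  obtain ⟨T, hT, hT'⟩ := ((eventually_ge_atTop (1:ℝ)).and
    (eventually_forall_ge_atTop.2 (hlim.eventually (gt_mem_nhds hl)))).exists
  have hTpos : 0 < T := by linarith
  have hF : ∀ t, 0 < t → 0 < ∫ u in (0:ℝ)..t, f u := fun t =>
    integral_pos_of_forall_pos hfpos hfint
  have hl0 : 0 ≤ l := (Real.rpow_nonneg zero_le_two _).trans hl.le
  refine tendsto_zero_of_doubling (M := (∫ u in (0:ℝ)..(2 * T), f u) * g T) hTpos hl0 hl1
    (mul_pos (hF _ (by linarith)) (hgpos T hTpos)).le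
    (fun t ht => (mul_pos (hF t (hTpos.trans_le ht)) (hgpos t (hTpos.trans_le ht))).le) ?_ ?_
  · intro t ht ht'
    have htpos := hTpos.trans_le ht
    have h1 := (hf.integral_sub_bounds hfint htpos ht').1
    have h2 : 0 ≤ (2 * T - t) * f (2 * T) :=
      mul_nonneg (by linarith) (hfpos _ (by linarith)).le
    exact mul_le_mul (by linarith) (hg (mem_Ioi.2 hTpos) (mem_Ioi.2 htpos) ht)
      (hgpos t htpos).le (hF _ (by linarith)).le
  · intro t ht
    have htpos := hTpos.trans_le ht
    have hFt := hF t htpos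
    have hgt := hgpos t htpos
    have h1 := (hf.integral_sub_bounds hfint (a := t) (b := 2 * t) htpos (by linarith)).2
    have h2 := hT' t ht
    calc (∫ u in (0:ℝ)..(2 * t), f u) * g (2 * t)
        ≤ ((∫ u in (0:ℝ)..t, f u) + t * f t) * g (2 * t) :=
          mul_le_mul_of_nonneg_right (by linarith) (hgpos _ (by linarith)).le
      _ = (1 + t * f t / ∫ u in (0:ℝ)..t, f u) * (g (2 * t) / g t) *
            ((∫ u in (0:ℝ)..t, f u) * g t) := by field_simp
      _ ≤ l * ((∫ u in (0:ℝ)..t, f u) * g t) := by gcongr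

open Filter MeasureTheory Set in
/-- Asymptotics of the convolution of regularly varying functions when the primitive of the first
one is slowly varying. -/
lemma tendsto_conv_div {f g : ℝ → ℝ} {θ ρ : ℝ} (hθ : 1 ≤ θ) (hρ : ρ < 1)
    (hf : AntitoneOn f (Ioi 0)) (hg : AntitoneOn g (Ioi 0))
    (hfpos : ∀ t > (0:ℝ), 0 < f t) (hgpos : ∀ t > (0:ℝ), 0 < g t)
    (hfint : ∀ t > (0:ℝ), IntegrableOn f (Ioc 0 t))
    (hgint : ∀ t > (0:ℝ), IntegrableOn g (Ioc 0 t))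
    (hfrv : ∀ c > (0:ℝ), Tendsto (fun t => f (c * t) / f t) atTop (nhds (c ^ (-θ))))
    (hgrv : ∀ c > (0:ℝ), Tendsto (fun t => g (c * t) / g t) atTop (nhds (c ^ (-ρ)))) :
    Tendsto (fun t => (∫ u in (0:ℝ)..t, f (t - u) * g u) / ((∫ u in (0:ℝ)..t, f u) * g t))
      atTop (nhds 1) := by
  have hsmall := tendsto_mul_div_integral_zero hθ hf hfpos hfint hfrv
  obtain ⟨M, hM0, hM⟩ := exists_integral_le_mul hρ hg hgpos hgint hgrv
  have hF : ∀ t, 0 < t → 0 < ∫ u in (0:ℝ)..t, f u := fun t =>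
    integral_pos_of_forall_pos hfpos hfint
  refine tendsto_order.2 ⟨fun a ha => ?_, fun a ha => ?_⟩
  · filter_upwards [eventually_gt_atTop 0] with t ht
    refine ha.trans_le ((one_le_div (mul_pos (hF t ht) (hgpos t ht))).2 ?_)
    exact hf.le_integral_conv hg hfpos hgpos hfint hgint ht
  · have hcont : Tendsto (fun c : ℝ => c ^ (-ρ)) (nhdsWithin 1 (Iio 1)) (nhds 1) := by
      have := (Real.continuousAt_rpow_const 1 (-ρ) (Or.inl one_ne_zero)).tendsto
      rw [Real.one_rpow] at this
      exact this.mono_left nhdsWithin_le_nhds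
    obtain ⟨c, hca, hc0, hc1⟩ := ((hcont.eventually (gt_mem_nhds ha)).and
      (Ioo_mem_nhdsLT (zero_lt_one (α := ℝ)))).exists
    have hlim := (((hfrv (1 - c) (sub_pos.2 hc1)).mul hsmall).const_mul M).add (hgrv c hc0)
    rw [mul_zero, mul_zero, zero_add] at hlim
    filter_upwards [eventually_gt_atTop 0, hM, hlim.eventually (gt_mem_nhds hca)] with t ht h1 h2
    refine lt_of_le_of_lt ?_ h2
    have hFt := hF t ht
    have hft := hfpos t ht
    have hgt := hgpos t ht
    have hct : 0 < c * t := mul_pos hc0 ht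
    have hctt : c * t < t := mul_lt_of_lt_one_left ht hc1
    have h3 := hf.integral_conv_le hg hfpos hgpos hfint hgint hct hctt
    have mono : ∀ {h : ℝ → ℝ}, AntitoneOn h (Ioi 0) → (∀ t > (0:ℝ), 0 < h t) →
        (∀ t > (0:ℝ), IntegrableOn h (Ioc 0 t)) → ∀ s, 0 < s → s ≤ t →
        ∫ u in (0:ℝ)..s, h u ≤ ∫ u in (0:ℝ)..t, h u := by
      intro h hh hpos hint s hs hst
      have h4 := (hh.integral_sub_bounds hint hs hst).1
      have h5 := mul_nonneg (sub_nonneg.2 hst) (hpos t ht).le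
      linarith
    have h4 := (mono hg hgpos hgint _ hct hctt.le).trans h1
    have h5 := mono hf hfpos hfint (t - c * t) (by linarith) (by linarith)
    have h6 : t - c * t = (1 - c) * t := by ring
    rw [h6] at h3 h5
    have hfc := hfpos ((1 - c) * t) (mul_pos (by linarith) ht)
    have hgc := hgpos (c * t) hct
    rw [div_le_iff₀ (mul_pos hFt hgt)]
    calc _ ≤ _ := h3
      _ ≤ f ((1 - c) * t) * (M * (t * g t)) + g (c * t) * ∫ u in (0:ℝ)..t, f u := by gcongr
      _ = _ := by field_simp

open Filter in
lemma tendsto_one_sub_exp_neg_div :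
    Tendsto (fun x : ℝ => (1 - Real.exp (-x)) / x) (nhdsWithin 0 {0}ᶜ) (nhds 1) := by
  have h : HasDerivAt (fun x : ℝ => 1 - Real.exp (-x)) 1 0 := by
    simpa using ((hasDerivAt_neg (0:ℝ)).exp).const_sub 1
  have := hasDerivAt_iff_tendsto_slope_zero.1 h
  simpa [div_eq_inv_mul] using this


open Filter MeasureTheory Real in
theorem stmt4
    (θ ρ : ℝ) (hθpos : 0 < θ) (hρpos : 0 < ρ)
    (r q : ℝ → ℝ)
    (hrpos : ∀ t > (0:ℝ), 0 < r t) (hqpos : ∀ t > (0:ℝ), 0 < q t)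
    (hranti : AntitoneOn r (Set.Ioi 0)) (hqanti : AntitoneOn q (Set.Ioi 0))
    (hrint : ∀ t > (0:ℝ), MeasureTheory.IntegrableOn r (Set.Ioc 0 t))
    (hqint : ∀ t > (0:ℝ), MeasureTheory.IntegrableOn q (Set.Ioc 0 t))
    (hrrv : ∀ c > (0:ℝ), Filter.Tendsto (fun t => r (c * t) / r t) Filter.atTop (nhds (c ^ (-θ))))
    (hqrv : ∀ c > (0:ℝ), Filter.Tendsto (fun t => q (c * t) / q t) Filter.atTop (nhds (c ^ (-ρ))))
    (R Q I P : ℝ → ℝ)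
    (hR : ∀ t, R t = ∫ u in (0:ℝ)..t, r u)
    (hQ : ∀ t, Q t = ∫ u in (0:ℝ)..t, q u)
    (hI : ∀ t, I t = ∫ u in (0:ℝ)..t, r (t - u) * q u)
    (hP : ∀ t, P t = 1 - Real.exp (-(I t)))
    (hθ : 1 ≤ θ) (hρ : ρ < 1) :
    Filter.Tendsto (fun t => I t / (R t * q t)) Filter.atTop (nhds 1)
    ∧ Filter.Tendsto I Filter.atTop (nhds 0)
    ∧ Filter.Tendsto (fun t => P t / (R t * q t)) Filter.atTop (nhds 1) := by
  have hconv := tendsto_conv_div hθ hρ hranti hqanti hrpos hqpos hrint hqint hrrv hqrv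
  simp only [← hR, ← hI] at hconv
  have hsmall := tendsto_mul_div_integral_zero hθ hranti hrpos hrint hrrv
  have hRq := tendsto_integral_mul_zero hρpos hranti hqanti hrpos hqpos hrint hsmall
    (hqrv 2 two_pos)
  simp only [← hR] at hRq
  have hne : ∀ t > (0:ℝ), 0 < R t * q t := fun t ht =>
    mul_pos (hR t ▸ integral_pos_of_forall_pos hrpos hrint ht) (hqpos t ht)
  have hIpos : ∀ t > (0:ℝ), 0 < I t := fun t ht => by
    have := hranti.le_integral_conv hqanti hrpos hqpos hrint hqint ht
    rw [← hR, ← hI] at this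
    exact (hne t ht).trans_le this
  have hI0 : Tendsto I atTop (nhds 0) := by
    have := hconv.mul hRq
    rw [mul_zero] at this
    refine this.congr' ?_
    filter_upwards [eventually_gt_atTop 0] with t ht
    exact div_mul_cancel₀ _ (hne t ht).ne'
  refine ⟨hconv, hI0, ?_⟩
  have hexp := tendsto_one_sub_exp_neg_div.comp (tendsto_nhdsWithin_iff.2 ⟨hI0,
    (eventually_gt_atTop 0).mono fun t ht => (hIpos t ht).ne'⟩)
  have := hexp.mul hconv
  rw [one_mul] at this
  refine this.congr' ?_
  filter_upwards [eventually_gt_atTop 0] with t ht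
  rw [Function.comp_apply, hP, div_mul_div_cancel₀ (hIpos t ht).ne']
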